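/- Let X be an infinite-dimensional Banach space with property (β) and let Y be an infinite-dimensional separable Banach space with property (M). Assume Y is the image of a uniform quotient map T from a subset of X which is Lipschitz for large distances. Then the norm of Y is asymptotically uniformly smooth, asymptotically uniformly convex, and there exists C ≥ 1 such that for all t ∈ (0,1], (1/C)·β̄_X(t/C) ≤ δ̄_Y(t). -/

import Mathlib

open Set Metric Filter Topology

noncomputable section

/-- `T` is a uniform quotient map on `S`: uniformly continuous and co-uniformly
continuous (with closed balls). -/
def UniformQuotientOn {X Y : Type*} [NormedAddCommGroup X] [NormedAddCommGroup Y]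
    (T : X → Y) (S : Set X) : Prop :=
  (∀ ε > 0, ∃ δ > 0, ∀ x ∈ S, ∀ x' ∈ S, ‖x - x'‖ ≤ δ → ‖T x - T x'‖ ≤ ε) ∧
  (∀ ε > 0, ∃ δ > 0, ∀ x ∈ S, closedBall (T x) δ ⊆ T '' (closedBall x ε ∩ S))

/-- The set of ratios `‖Tx - Tx'‖ / ‖x - x'‖` over pairs of points of `S` at distance `≥ d`. -/
def LargeDistRatioSet {X Y : Type*} [NormedAddCommGroup X] [NormedAddCommGroup Y]
    (T : X → Y) (S : Set X) (d : ℝ) : Set ℝ :=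
  {r | ∃ x ∈ S, ∃ x' ∈ S, d ≤ ‖x - x'‖ ∧ r = ‖T x - T x'‖ / ‖x - x'‖}

/-- `L_d^T`, the Lipschitz constant of `T` for distances `≥ d`. -/
noncomputable def Ld {X Y : Type*} [NormedAddCommGroup X] [NormedAddCommGroup Y]
    (T : X → Y) (S : Set X) (d : ℝ) : ℝ :=
  sSup (LargeDistRatioSet T S d)

/-- `T` is Lipschitz for large distances: `L_d^T < ∞` for every `d > 0`. -/
def LipschitzLargeDist {X Y : Type*} [NormedAddCommGroup X] [NormedAddCommGroup Y]
    (T : X → Y) (S : Set X) : Prop :=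
  ∀ d > 0, BddAbove (LargeDistRatioSet T S d)

/-- The set of co-Lipschitz constants valid for all radii `r ≥ d`. -/
def CoLipSet {X Y : Type*} [NormedAddCommGroup X] [NormedAddCommGroup Y]
    (T : X → Y) (S : Set X) (d : ℝ) : Set ℝ :=
  {c | 0 < c ∧ ∀ r, d ≤ r → ∀ x ∈ S, ∀ y : Y, ‖y - T x‖ < c * r →
      y ∈ T '' (closedBall x r ∩ S)}

/-- `c_d^T`. -/
noncomputable def cdT {X Y : Type*} [NormedAddCommGroup X] [NormedAddCommGroup Y]
    (T : X → Y) (S : Set X) (d : ℝ) : ℝ :=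
  sSup (CoLipSet T S d)

/-- `C^T = lim_{d → ∞} c_d^T` (the limit of the nondecreasing family `c_d^T`,
i.e. its supremum). -/
noncomputable def CT {X Y : Type*} [NormedAddCommGroup X] [NormedAddCommGroup Y]
    (T : X → Y) (S : Set X) : ℝ :=
  sSup {c | ∃ d, 0 < d ∧ c = cdT T S d}

/-- The set of admissible `δ`'s in the definition of the modulus `β̄_X(t)`. -/
def betaModSet (X : Type*) [NormedAddCommGroup X] (t : ℝ) : Set ℝ :=
  {δ | 0 ≤ δ ∧ ∀ x ∈ closedBall (0 : X) 1, ∀ xs : ℕ → X,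
      (∀ n, xs n ∈ closedBall (0 : X) 1) →
      (∀ m n, m ≠ n → t ≤ ‖xs m - xs n‖) →
      ∃ n, ‖x - xs n‖ / 2 ≤ 1 - δ}

/-- The modulus `β̄_X(t)` of property (β) of Rolewicz. -/
noncomputable def betaMod (X : Type*) [NormedAddCommGroup X] (t : ℝ) : ℝ :=
  sSup (betaModSet X t)

/-- Property (β) of Rolewicz. -/
def PropertyBeta (X : Type*) [NormedAddCommGroup X] : Prop :=
  ∃ a, 1 ≤ a ∧ a ≤ 2 ∧ ∀ t, 0 < t → t ≤ a → ∃ δ, 0 < δ ∧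
    ∀ x ∈ closedBall (0 : X) 1, ∀ xs : ℕ → X,
      (∀ n, xs n ∈ closedBall (0 : X) 1) →
      (∀ m n, m ≠ n → t ≤ ‖xs m - xs n‖) →
      ∃ n, ‖x - xs n‖ / 2 ≤ 1 - δ

/-- `Z` is a closed subspace of finite codimension. -/
def FinCodim {Y : Type*} [NormedAddCommGroup Y] [NormedSpace ℝ Y] (Z : Subspace ℝ Y) : Prop :=
  IsClosed (Z : Set Y) ∧ FiniteDimensional ℝ (Y ⧸ Z)

/-- `ρ̄_Y(t, y) = inf_Z sup_{z ∈ S_Z} (‖y + tz‖ - 1)`. -/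
noncomputable def rhoAt {Y : Type*} [NormedAddCommGroup Y] [NormedSpace ℝ Y]
    (t : ℝ) (y : Y) : ℝ :=
  sInf {s | ∃ Z : Subspace ℝ Y, FinCodim Z ∧
    s = sSup {r | ∃ z ∈ Z, ‖z‖ = 1 ∧ r = ‖y + t • z‖ - 1}}

/-- The modulus of asymptotic uniform smoothness `ρ̄_Y(t)`. -/
noncomputable def rhoMod (Y : Type*) [NormedAddCommGroup Y] [NormedSpace ℝ Y] (t : ℝ) : ℝ :=
  sSup {r | ∃ y : Y, ‖y‖ = 1 ∧ r = rhoAt t y}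

/-- `δ̄_Y(t, y) = sup_Z inf_{z ∈ S_Z} (‖y + tz‖ - 1)`. -/
noncomputable def deltaAt {Y : Type*} [NormedAddCommGroup Y] [NormedSpace ℝ Y]
    (t : ℝ) (y : Y) : ℝ :=
  sSup {s | ∃ Z : Subspace ℝ Y, FinCodim Z ∧
    s = sInf {r | ∃ z ∈ Z, ‖z‖ = 1 ∧ r = ‖y + t • z‖ - 1}}

/-- The modulus of asymptotic uniform convexity `δ̄_Y(t)`. -/
noncomputable def deltaMod (Y : Type*) [NormedAddCommGroup Y] [NormedSpace ℝ Y] (t : ℝ) : ℝ :=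
  sInf {r | ∃ y : Y, ‖y‖ = 1 ∧ r = deltaAt t y}

/-- The norm of `Y` is asymptotically uniformly smooth. -/
def AUS (Y : Type*) [NormedAddCommGroup Y] [NormedSpace ℝ Y] : Prop :=
  Tendsto (fun t => rhoMod Y t / t) (𝓝[>] 0) (𝓝 0)

/-- The norm of `Y` is asymptotically uniformly convex. -/
def AUC (Y : Type*) [NormedAddCommGroup Y] [NormedSpace ℝ Y] : Prop :=
  ∀ t > 0, 0 < deltaMod Y t

/-- A sequence is basic with basis constant at most `K`. -/
def IsBasicWithConst {Y : Type*} [NormedAddCommGroup Y] [NormedSpace ℝ Y]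
    (K : ℝ) (e : ℕ → Y) : Prop :=
  ∀ (a : ℕ → ℝ) (m n : ℕ), m ≤ n →
    ‖∑ i ∈ Finset.range m, a i • e i‖ ≤ K * ‖∑ i ∈ Finset.range n, a i • e i‖

/-- A weakly null sequence. -/
def WeaklyNull {Y : Type*} [NormedAddCommGroup Y] [NormedSpace ℝ Y] (xs : ℕ → Y) : Prop :=
  ∀ f : Y →L[ℝ] ℝ, Tendsto (fun n => f (xs n)) atTop (𝓝 0)

/-- Property (M) of Kalton. -/
def PropertyM (Y : Type*) [NormedAddCommGroup Y] [NormedSpace ℝ Y] : Prop :=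
  ∀ u v : Y, ‖u‖ = 1 → ‖v‖ = 1 → ∀ xs : ℕ → Y, WeaklyNull xs →
    limsup (fun n => ‖u + xs n‖) atTop = limsup (fun n => ‖v + xs n‖) atTop

/-- `N` is a norm on `X` equivalent to the given one. -/
def IsEquivNorm {X : Type*} [NormedAddCommGroup X] [NormedSpace ℝ X] (N : X → ℝ) : Prop :=
  (∀ x y, N (x + y) ≤ N x + N y) ∧
  (∀ (a : ℝ) (x : X), N (a • x) = |a| * N x) ∧
  (∃ c > 0, ∃ C > 0, ∀ x : X, c * ‖x‖ ≤ N x ∧ N x ≤ C * ‖x‖)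

/-- The norm `N` has property (β) of Rolewicz. -/
def NormHasPropertyBeta {X : Type*} [NormedAddCommGroup X] (N : X → ℝ) : Prop :=
  ∃ a, 1 ≤ a ∧ a ≤ 2 ∧ ∀ t, 0 < t → t ≤ a → ∃ δ, 0 < δ ∧
    ∀ x : X, N x ≤ 1 → ∀ xs : ℕ → X, (∀ n, N (xs n) ≤ 1) →
      (∀ m n, m ≠ n → t ≤ N (xs m - xs n)) →
      ∃ n, N (x - xs n) / 2 ≤ 1 - δ

lemma beta_scaled {X : Type*} [NormedAddCommGroup X] [NormedSpace ℝ X] {t δ : ℝ}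
    (h : ∀ x ∈ closedBall (0 : X) 1, ∀ xs : ℕ → X,
      (∀ n, xs n ∈ closedBall (0 : X) 1) →
      (∀ m n, m ≠ n → t ≤ ‖xs m - xs n‖) →
      ∃ n, ‖x - xs n‖ / 2 ≤ 1 - δ) {ρ : ℝ} (hρ : 0 < ρ) (p q : X) (qs : ℕ → X)
    (hp : ‖p - q‖ ≤ ρ) (hq : ∀ n, ‖qs n - q‖ ≤ ρ)
    (hs : ∀ m n, m < n → t * ρ ≤ ‖qs m - qs n‖) :
    ∃ n, ‖p - qs n‖ ≤ 2 * (1 - δ) * ρ := by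
  have key : ∀ a b : X, ‖ρ⁻¹ • (a - q) - ρ⁻¹ • (b - q)‖ = ‖a - b‖ / ρ := by
    intro a b
    rw [← smul_sub, norm_smul, Real.norm_of_nonneg (by positivity)]
    rw [sub_sub_sub_cancel_right]; field_simp
  have key0 : ∀ a : X, ‖a - q‖ ≤ ρ → ρ⁻¹ • (a - q) ∈ closedBall (0 : X) 1 := by
    intro a ha
    rw [mem_closedBall_zero_iff, norm_smul, Real.norm_of_nonneg (by positivity)]
    rw [inv_mul_le_iff₀ hρ]; simpa using ha
  obtain ⟨n, hn⟩ := h (ρ⁻¹ • (p - q)) (key0 p hp) (fun n => ρ⁻¹ • (qs n - q))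
    (fun n => key0 _ (hq n)) (by
      intro m n hmn
      rw [key, le_div_iff₀ hρ]
      rcases lt_or_gt_of_ne hmn with h1 | h1
      · exact hs m n h1
      · rw [norm_sub_rev]; exact hs n m h1)
  refine ⟨n, ?_⟩
  rw [key] at hn
  have : ‖p - qs n‖ = ‖p - qs n‖ / ρ / 2 * (2 * ρ) := by field_simp
  rw [this]
  nlinarith

lemma lip_large {X Y : Type*} [NormedAddCommGroup X] [NormedAddCommGroup Y]
    {S : Set X} {T : X → Y} (hT : UniformQuotientOn T S) (hLip : LipschitzLargeDist T S) :
    ∃ L : ℝ, 1 ≤ L ∧ ∀ x ∈ S, ∀ x' ∈ S, ‖T x - T x'‖ ≤ L * ‖x - x'‖ + 1 := by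
  obtain ⟨δ, hδ, h⟩ := hT.1 1 one_pos
  obtain ⟨L, hL⟩ := hLip δ hδ
  refine ⟨max L 1, le_max_right _ _, fun x hx x' hx' => ?_⟩
  have h0 := norm_nonneg (x - x')
  have h1 : (1:ℝ) ≤ max L 1 := le_max_right _ _
  have h2 : L ≤ max L 1 := le_max_left _ _
  rcases le_total ‖x - x'‖ δ with hd | hd
  · have := h x hx x' hx' hd
    nlinarith
  · have := hL ⟨x, hx, x', hx', hd, rfl⟩
    rw [div_le_iff₀ (by linarith)] at this
    nlinarith

lemma colip_large {X Y : Type*} [NormedAddCommGroup X] [NormedAddCommGroup Y] [NormedSpace ℝ Y]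
    {S : Set X} {T : X → Y} (hT : UniformQuotientOn T S) :
    ∃ c : ℝ, 0 < c ∧ ∀ r : ℝ, 1 ≤ r → ∀ x ∈ S, ∀ y : Y, ‖y - T x‖ ≤ c * r →
      ∃ x' ∈ S, ‖x' - x‖ ≤ r ∧ T x' = y := by
  obtain ⟨δ, hδ, h⟩ := hT.2 1 one_pos
  have hn : ∀ n : ℕ, ∀ x ∈ S, ∀ y : Y, ‖y - T x‖ ≤ δ * n →
      ∃ x' ∈ S, ‖x' - x‖ ≤ n ∧ T x' = y := by
    intro n
    induction n with
    | zero =>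
      intro x hx y hy
      refine ⟨x, hx, by simp, ?_⟩
      simp only [Nat.cast_zero, mul_zero] at hy
      have := norm_le_zero_iff.1 hy
      exact (sub_eq_zero.1 this).symm
    | succ n ih =>
      intro x hx y hy
      have hn0 : (0:ℝ) < n + 1 := by positivity
      push_cast at hy
      have e1 : T x + ((n:ℝ)+1)⁻¹ • (y - T x) ∈ closedBall (T x) δ := by
        rw [mem_closedBall, dist_eq_norm, add_sub_cancel_left, norm_smul,
          Real.norm_of_nonneg (by positivity), inv_mul_le_iff₀ hn0]
        linarith
      obtain ⟨x1, ⟨hx1, hx1S⟩, hx1T⟩ := h x hx e1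
      obtain ⟨x2, hx2S, hx2, hx2T⟩ := ih x1 hx1S y (by
        rw [hx1T]
        have : y - (T x + ((n:ℝ)+1)⁻¹ • (y - T x)) = ((n:ℝ) / (n+1)) • (y - T x) := by
          have h3 : (n:ℝ) / (n+1) = 1 - ((n:ℝ)+1)⁻¹ := by field_simp; ring
          rw [h3, sub_smul, one_smul]; abel
        rw [this, norm_smul, Real.norm_of_nonneg (by positivity), div_mul_eq_mul_div,
          div_le_iff₀ hn0]
        nlinarith [(Nat.cast_nonneg n : (0:ℝ) ≤ n)])
      refine ⟨x2, hx2S, ?_, hx2T⟩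
      rw [mem_closedBall, dist_eq_norm] at hx1
      have := norm_add_le (x2 - x1) (x1 - x)
      rw [sub_add_sub_cancel] at this
      push_cast; linarith
  refine ⟨δ / 2, by positivity, fun r hr x hx y hy => ?_⟩
  have h1 := Nat.floor_le (by linarith : 0 ≤ r)
  have h2 := Nat.lt_floor_add_one r
  have h3 : (1:ℝ) ≤ ⌊r⌋₊ := by exact_mod_cast (Nat.one_le_floor_iff r).2 hr
  obtain ⟨x', a, b, c⟩ := hn ⌊r⌋₊ x hx y (by nlinarith)
  exact ⟨x', a, b.trans h1, c⟩

lemma exists_subseq_fin (P : Finset ℕ → ℕ → Prop) (h : ∀ F, ∀ᶠ n in atTop, P F n) :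
    ∃ σ : ℕ → ℕ, StrictMono σ ∧ ∀ n, ∀ F : Finset ℕ, F ⊆ (Finset.range n).image σ → P F (σ n) := by
  simp only [eventually_atTop] at h
  choose N hN using h
  let g : ℕ → ℕ := fun s => max (s + 1) ((Finset.range (s + 1)).powerset.sup N)
  let σ : ℕ → ℕ := fun n => Nat.rec (N ∅) (fun _ s => g s) n
  have hs : ∀ n, σ (n + 1) = g (σ n) := fun n => rfl
  have hmono : StrictMono σ := strictMono_nat_of_lt_succ (fun n => by
    rw [hs]; exact lt_of_lt_of_le (Nat.lt_succ_self _) (le_max_left _ _))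
  refine ⟨σ, hmono, fun n F hF => ?_⟩
  cases n with
  | zero =>
    have : F = ∅ := by simpa using hF
    subst this
    exact hN _ _ le_rfl
  | succ n =>
    apply hN
    rw [hs]
    refine le_trans ?_ (le_max_right _ _)
    apply Finset.le_sup (f := N)
    rw [Finset.mem_powerset]
    intro a ha
    obtain ⟨i, hi, rfl⟩ := Finset.mem_image.1 (hF ha)
    rw [Finset.mem_range] at hi ⊢
    exact Nat.lt_succ_of_le (hmono.monotone (by omega))

lemma tree_lemma {X Y : Type*} [NormedAddCommGroup X] [NormedSpace ℝ X]
    [NormedAddCommGroup Y] [NormedSpace ℝ Y]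
    (hβ : PropertyBeta X) {S : Set X} {T : X → Y} (hsurj : T '' S = Set.univ)
    {L : ℝ} (hL1 : 1 ≤ L) (hL : ∀ x ∈ S, ∀ x' ∈ S, ‖T x - T x'‖ ≤ L * ‖x - x'‖ + 1)
    {c0 : ℝ} (hc0 : 0 < c0) (hco : ∀ r : ℝ, 1 ≤ r → ∀ x ∈ S, ∀ y : Y, ‖y - T x‖ ≤ c0 * r →
      ∃ x' ∈ S, ‖x' - x‖ ≤ r ∧ T x' = y) (c : ℝ) (hc : 0 < c) :
    ∃ K : ℕ, ∀ w : ℕ → Y, (∀ n, ‖w n‖ ≤ 1) →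
      (∀ A : Finset ℕ, ∃ N, ∀ B : Finset ℕ, (∀ b ∈ B, N ≤ b) →
        ‖∑ i ∈ A, w i‖ ≤ 2 * ‖∑ i ∈ A, w i - ∑ i ∈ B, w i‖) →
      ¬ (∀ A : Finset ℕ, A.card ≤ K → c * A.card ≤ ‖∑ i ∈ A, w i‖) := by
  obtain ⟨a, ha1, -, hβ⟩ := hβ
  have ht0 : 0 < min 1 (c * c0 / (4 * L)) := lt_min one_pos (by positivity)
  have ht1 : min 1 (c * c0 / (4 * L)) ≤ a := (min_le_left _ _).trans ha1
  have ht2 : min 1 (c * c0 / (4 * L)) ≤ c * c0 / (4 * L) := min_le_right _ _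
  set t := min 1 (c * c0 / (4 * L)) with ht
  obtain ⟨δ', hδ', hβ'⟩ := hβ t ht0 ht1
  obtain ⟨δ, hδ, hδ1, hδ2⟩ : ∃ δ, 0 < δ ∧ δ ≤ 1/2 ∧ δ ≤ δ' :=
    ⟨min (1/2) δ', lt_min (by norm_num) hδ', min_le_left _ _, min_le_right _ _⟩
  obtain ⟨J, hJ⟩ := exists_pow_lt_of_lt_one (show 0 < c * c0 / (4 * L) by positivity)
    (show 1 - δ < 1 by linarith)
  refine ⟨2 ^ J, fun w hw hA hcard => ?_⟩
  obtain ⟨R, hR1, hR2⟩ : ∃ R : ℝ, 4 / c ≤ R ∧ c0 ≤ R := ⟨max (4/c) c0, le_max_left _ _, le_max_right _ _⟩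
  have hR0 : 0 < R := by linarith
  have hcR : 4 ≤ R * c := by rwa [div_le_iff₀ hc] at hR1
  set D := R / c0 with hD
  have hD1 : 1 ≤ D := by rw [hD, le_div_iff₀ hc0]; linarith
  have hRD : R = c0 * D := by rw [hD]; field_simp
  -- separation in X from separation in Y
  have sep : ∀ x ∈ S, ∀ x' ∈ S, ∀ m : ℝ, 1 ≤ m → R * (c / 2) * m ≤ ‖T x - T x'‖ →
      c * c0 / (4 * L) * (D * m) ≤ ‖x - x'‖ := by
    intro x hx x' hx' m hm h
    have h1 := hL x hx x' hx'
    have h2 : c * c0 / (4 * L) * (D * m) = (R * c * m / 4) / L := by rw [hRD]; field_simp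
    rw [h2, div_le_iff₀ (by linarith)]
    nlinarith
  have main : ∀ j ≤ J, ∀ x ∈ S, ∀ N : ℕ, ∃ A : Finset ℕ, (∀ b ∈ A, N ≤ b) ∧ A.card = 2 ^ j ∧
      ∃ x' ∈ S, T x' = T x + R • ∑ i ∈ A, w i ∧ ‖x' - x‖ ≤ D * 2 ^ j * (1 - δ) ^ j := by
    intro j
    induction j with
    | zero =>
      intro _ x hx N
      obtain ⟨x', hx', h1, h2⟩ := hco D hD1 x hx (T x + R • w N) (by
        rw [add_sub_cancel_left, norm_smul, Real.norm_of_nonneg hR0.le, ← hRD]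
        nlinarith [hw N])
      exact ⟨{N}, by simp, by simp, x', hx', by simpa using h2, by simpa using h1⟩
    | succ j ih =>
      intro hj x hx N
      have ih := ih (by omega)
      set ℓ := D * 2 ^ j * (1 - δ) ^ j with hℓ
      have hpow : (1 - δ) ^ j ≤ 1 := pow_le_one₀ (by linarith) (by linarith)
      have hpow0 : 0 < (1 - δ) ^ j := pow_pos (by linarith) _
      have h2j : (1:ℝ) ≤ 2 ^ j := one_le_pow₀ (by norm_num)
      have hℓ0 : 0 < ℓ := by positivity
      have hℓ1 : ℓ ≤ D * 2 ^ j := by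
        rw [hℓ]; exact mul_le_of_le_one_right (by positivity) hpow
      have hcj : 2 ^ j ≤ 2 ^ J := Nat.pow_le_pow_right (by norm_num) (by omega)
      obtain ⟨A1, hA1, hA1c, x1, hx1, hTx1, hn1⟩ := ih x hx N
      let N1 := max N (A1.sup id + 1)
      obtain ⟨f, hf, hfr⟩ := exists_seq_of_forall_finset_exists
        (fun p : Finset ℕ × X => (∀ b ∈ p.1, N1 ≤ b) ∧ p.1.card = 2 ^ j ∧ p.2 ∈ S ∧
          T p.2 = T x1 + R • ∑ i ∈ p.1, w i ∧ ‖p.2 - x1‖ ≤ ℓ)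
        (fun p q => ‖∑ i ∈ p.1, w i‖ ≤ 2 * ‖∑ i ∈ p.1, w i - ∑ i ∈ q.1, w i‖) (by
          intro s _
          choose M hM using hA
          obtain ⟨B, h1, h2, x2, h3, h4, h5⟩ := ih x1 hx1 (max N1 (s.sup (fun p => M p.1)))
          refine ⟨(B, x2), ⟨fun b hb => (le_max_left _ _).trans (h1 b hb), h2, h3, h4, h5⟩, ?_⟩
          intro p hp
          apply hM
          intro b hb
          exact ((Finset.le_sup (f := fun p : Finset ℕ × X => M p.1) hp).trans
            (le_max_right _ _)).trans (h1 b hb))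
      obtain ⟨n, hn⟩ := beta_scaled hβ' hℓ0 x x1 (fun n => (f n).2)
        (by rw [norm_sub_rev]; exact hn1) (fun n => (hf n).2.2.2.2) (by
          intro m n hmn
          have h1 := hfr m n hmn
          have h2 := hcard (f m).1 (by rw [(hf m).2.1]; exact hcj)
          rw [(hf m).2.1] at h2
          push_cast at h2
          have h3 := sep _ (hf m).2.2.1 _ (hf n).2.2.1 (2 ^ j) h2j (by
            rw [(hf m).2.2.2.1, (hf n).2.2.2.1, add_sub_add_left_eq_sub, ← smul_sub, norm_smul,
              Real.norm_of_nonneg hR0.le, mul_assoc]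
            apply mul_le_mul_of_nonneg_left _ hR0.le
            linarith)
          refine le_trans ?_ h3
          exact mul_le_mul ht2 hℓ1 hℓ0.le (by positivity))
      have hdisj : Disjoint A1 (f n).1 := by
        rw [Finset.disjoint_left]
        intro b hb hb'
        have h1 := (hf n).1 b hb'
        have h2 : b ≤ A1.sup id := Finset.le_sup (f := id) hb
        have h3 : A1.sup id + 1 ≤ N1 := le_max_right _ _
        omega
      refine ⟨A1 ∪ (f n).1, ?_, ?_, (f n).2, (hf n).2.2.1, ?_, ?_⟩
      · intro b hb
        rcases Finset.mem_union.1 hb with h | h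
        · exact hA1 b h
        · exact (le_max_left _ _).trans ((hf n).1 b h)
      · rw [Finset.card_union_of_disjoint hdisj, hA1c, (hf n).2.1]; ring
      · rw [(hf n).2.2.2.1, hTx1, Finset.sum_union hdisj, smul_add, add_assoc]
      · rw [norm_sub_rev]
        refine hn.trans ?_
        calc 2 * (1 - δ') * ℓ ≤ 2 * (1 - δ) * ℓ := by nlinarith
          _ = _ := by rw [hℓ]; ring
  have hne : ∃ x, x ∈ S := by
    have : (0:Y) ∈ T '' S := by rw [hsurj]; trivial
    obtain ⟨x, hx, -⟩ := this
    exact ⟨x, hx⟩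
  obtain ⟨x, hx⟩ := hne
  obtain ⟨A, -, hAc, x', hx', hTx', hn⟩ := main J le_rfl x hx 0
  have h2 := hcard A hAc.le
  rw [hAc] at h2
  push_cast at h2
  have h2J : (1:ℝ) ≤ 2 ^ J := one_le_pow₀ (by norm_num)
  have h3 := sep _ hx' _ hx (2 ^ J) h2J (by
    rw [hTx', add_sub_cancel_left, norm_smul, Real.norm_of_nonneg hR0.le, mul_assoc]
    apply mul_le_mul_of_nonneg_left _ hR0.le
    have : 0 < c * 2 ^ J := by positivity
    linarith)
  have h4 : D * 2 ^ J * (1 - δ) ^ J < D * 2 ^ J * (c * c0 / (4 * L)) :=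
    mul_lt_mul_of_pos_left hJ (by positivity)
  linarith

def NoTree (Y : Type*) [NormedAddCommGroup Y] : Prop :=
  ∀ c : ℝ, 0 < c → ∃ K : ℕ, ∀ w : ℕ → Y, (∀ n, ‖w n‖ ≤ 1) →
      (∀ A : Finset ℕ, ∃ N, ∀ B : Finset ℕ, (∀ b ∈ B, N ≤ b) →
        ‖∑ i ∈ A, w i‖ ≤ 2 * ‖∑ i ∈ A, w i - ∑ i ∈ B, w i‖) →
      ¬ (∀ A : Finset ℕ, A.card ≤ K → c * A.card ≤ ‖∑ i ∈ A, w i‖)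

lemma exists_normseq (Y : Type*) [NormedAddCommGroup Y] [NormedSpace ℝ Y]
    [TopologicalSpace.SeparableSpace Y] :
    ∃ f : ℕ → Y →L[ℝ] ℝ, (∀ k, ‖f k‖ ≤ 1) ∧ ∀ e, ∃ k, ‖e‖ ≤ 2 * |f k e| := by
  have h := fun k => exists_dual_vector'' ℝ (TopologicalSpace.denseSeq Y k)
  choose f hf1 hf2 using h
  refine ⟨f, hf1, fun e => ?_⟩
  by_cases he : e = 0
  · exact ⟨0, by simp [he]⟩
  have hp : 0 < ‖e‖ / 4 := by have := norm_pos_iff.2 he; positivity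
  obtain ⟨k, hk⟩ := (TopologicalSpace.denseRange_denseSeq Y).exists_dist_lt e hp
  refine ⟨k, ?_⟩
  set d := TopologicalSpace.denseSeq Y k
  rw [dist_eq_norm] at hk
  have h1 : |f k (e - d)| ≤ ‖e - d‖ := by
    have := (f k).le_opNorm (e - d)
    rw [Real.norm_eq_abs] at this
    nlinarith [hf1 k, norm_nonneg (e - d)]
  rw [map_sub, hf2] at h1
  have h2 := norm_sub_norm_le e d
  have h3 := (abs_le.1 h1).1
  have h4 := le_abs_self (f k e)
  simp only [RCLike.ofReal_real_eq_id, id] at h3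
  linarith

lemma mazur {Y : Type*} [NormedAddCommGroup Y] [NormedSpace ℝ Y]
    {f : ℕ → Y →L[ℝ] ℝ} (hf1 : ∀ k, ‖f k‖ ≤ 1) (hf2 : ∀ e, ∃ k, ‖e‖ ≤ 2 * |f k e|)
    {z : ℕ → Y} (hz : ∀ n, ∀ k < n, f k (z n) = 0) :
    ∀ A : Finset ℕ, ∃ N, ∀ B : Finset ℕ, (∀ b ∈ B, N ≤ b) →
        ‖∑ i ∈ A, z i‖ ≤ 2 * ‖∑ i ∈ A, z i - ∑ i ∈ B, z i‖ := by
  intro A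
  obtain ⟨k, hk⟩ := hf2 (∑ i ∈ A, z i)
  refine ⟨k + 1, fun B hB => hk.trans ?_⟩
  have h0 : f k (∑ i ∈ B, z i) = 0 := by
    rw [map_sum]
    exact Finset.sum_eq_zero (fun b hb => hz b k (hB b hb))
  have h1 := (f k).le_opNorm (∑ i ∈ A, z i - ∑ i ∈ B, z i)
  rw [map_sub, h0, sub_zero, Real.norm_eq_abs] at h1
  nlinarith [hf1 k, norm_nonneg (∑ i ∈ A, z i - ∑ i ∈ B, z i)]

lemma weaklyNull_of {Y : Type*} [NormedAddCommGroup Y] [NormedSpace ℝ Y] (hN : NoTree Y)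
    {f : ℕ → Y →L[ℝ] ℝ} (hf1 : ∀ k, ‖f k‖ ≤ 1) (hf2 : ∀ e, ∃ k, ‖e‖ ≤ 2 * |f k e|)
    {z : ℕ → Y} (hz : ∀ n, ∀ k < n, f k (z n) = 0) (hz1 : ∀ n, ‖z n‖ ≤ 1) : WeaklyNull z := by
  have key : ∀ (g : Y →L[ℝ] ℝ) (ε : ℝ), 0 < ε → ¬ ∃ᶠ n in atTop, ε ≤ g (z n) := by
    intro g ε hε h
    obtain ⟨σ, hσ, hg⟩ := extraction_of_frequently_atTop h
    have hgp : 0 < ‖g‖ + 1 := by positivity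
    obtain ⟨K, hK⟩ := hN (ε / (‖g‖ + 1)) (by positivity)
    refine hK (z ∘ σ) (fun n => hz1 _) (mazur hf1 hf2 ?_) ?_
    · intro n k hk
      exact hz _ _ (hk.trans_le (hσ.id_le n))
    · intro A _
      rw [div_mul_eq_mul_div, div_le_iff₀ hgp]
      have h1 : ε * A.card ≤ g (∑ i ∈ A, (z ∘ σ) i) := by
        rw [map_sum]
        have := Finset.card_nsmul_le_sum A (fun i => g ((z ∘ σ) i)) ε (fun i _ => hg i)
        rw [nsmul_eq_mul] at this; linarith
      have h2 := (le_abs_self _).trans (g.le_opNorm (∑ i ∈ A, (z ∘ σ) i))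
      nlinarith [norm_nonneg (∑ i ∈ A, (z ∘ σ) i)]
  intro g
  rw [Metric.tendsto_atTop']
  intro ε hε
  have h1 := not_frequently.1 (key g ε hε)
  have h2 := not_frequently.1 (key (-g) ε hε)
  obtain ⟨N, hN⟩ := eventually_atTop.1 (h1.and h2)
  refine ⟨N, fun n hn => ?_⟩
  obtain ⟨h3, h4⟩ := hN n hn.le
  rw [Real.dist_eq, sub_zero, abs_lt]
  simp only [neg_apply] at h4
  constructor <;> linarith

lemma exists_Z {Y : Type*} [NormedAddCommGroup Y] [NormedSpace ℝ Y] (hY : ¬ FiniteDimensional ℝ Y)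
    (f : ℕ → Y →L[ℝ] ℝ) (n : ℕ) :
    ∃ Z : Subspace ℝ Y, FinCodim Z ∧ (∀ z ∈ Z, ∀ k < n, f k z = 0) ∧ ∃ z ∈ Z, ‖z‖ = 1 := by
  let F : Y →L[ℝ] (Fin n → ℝ) := ContinuousLinearMap.pi (fun i => f i)
  refine ⟨LinearMap.ker (F : Y →ₗ[ℝ] (Fin n → ℝ)), ⟨?_, ?_⟩, ?_, ?_⟩
  · exact F.isClosed_ker
  · exact (LinearMap.quotKerEquivRange (F : Y →ₗ[ℝ] (Fin n → ℝ))).symm.finiteDimensional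
  · intro z hz k hk
    have : F z = 0 := hz
    exact congrFun this ⟨k, hk⟩
  · have hne : LinearMap.ker (F : Y →ₗ[ℝ] (Fin n → ℝ)) ≠ ⊥ := by
      intro h
      exact hY (FiniteDimensional.of_injective _ (LinearMap.ker_eq_bot.1 h))
    obtain ⟨z, hz, hz0⟩ := Submodule.exists_mem_ne_zero_of_ne_bot hne
    refine ⟨(‖z‖⁻¹ : ℝ) • z, Submodule.smul_mem _ _ hz, ?_⟩
    rw [norm_smul, norm_inv, norm_norm, inv_mul_cancel₀ (norm_ne_zero_iff.2 hz0)]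

lemma bdd_limsup {Y : Type*} [NormedAddCommGroup Y] {u : Y} {z : ℕ → Y} {C : ℝ}
    (hz : ∀ n, ‖z n‖ ≤ C) :
    IsBoundedUnder (· ≤ ·) atTop (fun n => ‖u + z n‖) ∧
    IsCoboundedUnder (· ≤ ·) atTop (fun n => ‖u + z n‖) := by
  constructor
  · exact isBoundedUnder_of ⟨‖u‖ + C, fun n => (norm_add_le _ _).trans (by linarith [hz n])⟩
  · exact (isBoundedUnder_of ⟨0, fun n => norm_nonneg _⟩ :
      IsBoundedUnder (· ≥ ·) atTop (fun n => ‖u + z n‖)).isCoboundedUnder_le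

lemma M_eventually {Y : Type*} [NormedAddCommGroup Y] [NormedSpace ℝ Y] (hM : PropertyM Y)
    {x : ℕ → Y} (hx : WeaklyNull x) {C : ℝ} (hC : ∀ n, ‖x n‖ ≤ C) {y v : Y} (hy : ‖y‖ = 1)
    (hv : ‖v‖ = 1) {a b : ℝ} (hab : a < b) (h : ∀ n, ‖y + x n‖ ≤ a) :
    ∀ᶠ n in atTop, ‖v + x n‖ < b := by
  have h1 : limsup (fun n => ‖y + x n‖) atTop ≤ a :=
    limsup_le_of_le (bdd_limsup hC).2 (Eventually.of_forall h)
  rw [hM y v hy hv x hx] at h1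
  exact eventually_lt_of_limsup_lt (h1.trans_lt hab) (bdd_limsup hC).1

lemma WeaklyNull.smul {Y : Type*} [NormedAddCommGroup Y] [NormedSpace ℝ Y]
    {x : ℕ → Y} (hx : WeaklyNull x) (t : ℝ) : WeaklyNull (fun n => t • x n) := by
  intro f
  simpa using (hx f).const_mul t

lemma WeaklyNull.subseq {Y : Type*} [NormedAddCommGroup Y] [NormedSpace ℝ Y]
    {x : ℕ → Y} (hx : WeaklyNull x) {σ : ℕ → ℕ} (hσ : StrictMono σ) :
    WeaklyNull (fun n => x (σ n)) :=
  fun f => (hx f).comp hσ.tendsto_atTop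

lemma norm_convex {Y : Type*} [NormedAddCommGroup Y] [NormedSpace ℝ Y] (v z : Y) {s a : ℝ}
    (hs : 0 ≤ s) (hs1 : s ≤ 1) :
    ‖v + (s * a) • z‖ ≤ (1 - s) * ‖v‖ + s * ‖v + a • z‖ := by
  have : v + (s * a) • z = (1 - s) • v + s • (v + a • z) := by
    rw [smul_add, sub_smul, one_smul, smul_smul]; abel
  rw [this]
  refine (norm_add_le _ _).trans ?_
  rw [norm_smul, norm_smul, Real.norm_of_nonneg hs, Real.norm_of_nonneg (by linarith)]

/-- growth step used for asymptotic uniform smoothness -/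
lemma growth {Y : Type*} [NormedAddCommGroup Y] [NormedSpace ℝ Y] (hM : PropertyM Y)
    {z : ℕ → Y} (hz : WeaklyNull z) (hz1 : ∀ n, ‖z n‖ = 1) {y : Y} (hy : ‖y‖ = 1) {t c : ℝ}
    (ht : 0 < t) (hc : 0 < c) (h : ∀ n, 1 + c * t ≤ ‖y + t • z n‖) (u : Y) (hu : ‖u‖ * t ≤ 1) :
    ∀ᶠ n in atTop, ‖u‖ + c / 2 ≤ ‖u + z n‖ := by
  have htz : ∀ n, ‖t • z n‖ = t := by
    intro n; rw [norm_smul, hz1, Real.norm_of_nonneg ht.le, mul_one]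
  have hc1 : c ≤ 1 := by
    have h1 := h 0
    have h2 := norm_add_le y (t • z 0)
    rw [htz, hy] at h2
    by_contra hcc
    push Not at hcc
    nlinarith
  by_cases hu0 : u = 0
  · refine Eventually.of_forall (fun n => ?_)
    rw [hu0, norm_zero, zero_add, zero_add, hz1]; linarith
  have hup : 0 < ‖u‖ := norm_pos_iff.2 hu0
  by_contra hcon
  rw [not_eventually] at hcon
  obtain ⟨σ, hσ, hg⟩ := extraction_of_frequently_atTop hcon
  push Not at hg
  have hv : ‖(‖u‖⁻¹ : ℝ) • u‖ = 1 := by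
    rw [norm_smul, norm_inv, norm_norm, inv_mul_cancel₀ hup.ne']
  have hle : ∀ n, ‖(‖u‖⁻¹ : ℝ) • u + t • z (σ n)‖ ≤ 1 + c * t / 2 := by
    intro n
    have e1 : t = (‖u‖ * t) * ‖u‖⁻¹ := by field_simp
    have h1 := norm_convex ((‖u‖⁻¹ : ℝ) • u) (z (σ n)) (a := ‖u‖⁻¹)
      (by positivity : 0 ≤ ‖u‖ * t) hu
    rw [← e1, hv, ← smul_add, norm_smul (‖u‖⁻¹) (u + z (σ n)), norm_inv, norm_norm] at h1
    have e2 : ‖u‖ * t * (‖u‖⁻¹ * ‖u + z (σ n)‖) = t * ‖u + z (σ n)‖ := by field_simp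
    rw [e2] at h1
    nlinarith [hg n]
  have hev := M_eventually hM ((hz.subseq hσ).smul t) (fun n => (htz (σ n)).le) hv hy
    (show 1 + c * t / 2 < 1 + c * t by nlinarith [mul_pos hc ht]) hle
  obtain ⟨n, hn⟩ := hev.exists
  exact absurd (h (σ n)) (not_le.2 hn)

lemma rho_bdd {Y : Type*} [NormedAddCommGroup Y] [NormedSpace ℝ Y] {t : ℝ} (ht : 0 < t) {y z : Y}
    (hy : ‖y‖ = 1) (hz : ‖z‖ = 1) : ‖y + t • z‖ - 1 ≤ t := by
  have := norm_add_le y (t • z)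
  rw [norm_smul, hz, hy, Real.norm_of_nonneg ht.le] at this
  linarith

lemma rho_sup_nonneg {Y : Type*} [NormedAddCommGroup Y] [NormedSpace ℝ Y] {t : ℝ} (ht : 0 < t)
    {y : Y} (hy : ‖y‖ = 1) (Z : Subspace ℝ Y) :
    0 ≤ sSup {r | ∃ z ∈ Z, ‖z‖ = 1 ∧ r = ‖y + t • z‖ - 1} := by
  by_cases hne : ∃ z ∈ Z, ‖z‖ = 1
  · obtain ⟨z, hz, hz1⟩ := hne
    have hb : BddAbove {r | ∃ z ∈ Z, ‖z‖ = 1 ∧ r = ‖y + t • z‖ - 1} := by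
      refine ⟨t, ?_⟩
      rintro _ ⟨z, -, h1, rfl⟩
      exact rho_bdd ht hy h1
    have h1 := le_csSup hb ⟨z, hz, hz1, rfl⟩
    have h2 := le_csSup hb ⟨-z, Z.neg_mem hz, by rw [norm_neg, hz1], rfl⟩
    have h3 := norm_add_le (y + t • z) (y + t • (-z))
    have h4 : y + t • z + (y + t • (-z)) = (2:ℝ) • y := by rw [smul_neg, two_smul]; abel
    rw [h4, norm_smul, hy] at h3
    norm_num at h3
    simp only [smul_neg] at h2
    linarith
  · apply Real.sSup_nonneg
    rintro _ ⟨z, h1, h2, -⟩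
    exact absurd ⟨z, h1, h2⟩ hne

lemma rhoMod_seq {Y : Type*} [NormedAddCommGroup Y] [NormedSpace ℝ Y]
    (hY : ¬ FiniteDimensional ℝ Y) (f : ℕ → Y →L[ℝ] ℝ) {t b : ℝ} (ht : 0 < t) (hb : 0 ≤ b)
    (h : b < rhoMod Y t) :
    ∃ y : Y, ‖y‖ = 1 ∧ ∃ z : ℕ → Y, (∀ n, ‖z n‖ = 1) ∧ (∀ n, ∀ k < n, f k (z n) = 0) ∧
      ∀ n, 1 + b ≤ ‖y + t • z n‖ := by
  obtain ⟨_, ⟨y, hy, rfl⟩, hby⟩ := exists_lt_of_lt_csSup (by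
    by_contra hne
    rw [Set.not_nonempty_iff_eq_empty] at hne
    rw [rhoMod, hne, Real.sSup_empty] at h
    linarith) h
  refine ⟨y, hy, ?_⟩
  have : ∀ n, ∃ z : Y, ‖z‖ = 1 ∧ (∀ k < n, f k z = 0) ∧ 1 + b ≤ ‖y + t • z‖ := by
    intro n
    obtain ⟨Z, hZ, hZf, z0, hz0, hz01⟩ := exists_Z hY f n
    have h1 : rhoAt t y ≤ sSup {r | ∃ z ∈ Z, ‖z‖ = 1 ∧ r = ‖y + t • z‖ - 1} := by
      apply csInf_le
      · refine ⟨0, ?_⟩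
        rintro _ ⟨Z, -, rfl⟩
        exact rho_sup_nonneg ht hy Z
      · exact ⟨Z, hZ, rfl⟩
    obtain ⟨_, ⟨z, hz, hz1, rfl⟩, hlt⟩ := exists_lt_of_lt_csSup (by exact ⟨_, z0, hz0, hz01, rfl⟩) (hby.trans_le h1)
    exact ⟨z, hz1, hZf z hz, by linarith⟩
  choose z h1 h2 h3 using this
  exact ⟨z, h1, h2, h3⟩

lemma aus_of {Y : Type*} [NormedAddCommGroup Y] [NormedSpace ℝ Y]
    [TopologicalSpace.SeparableSpace Y]
    (hY : ¬ FiniteDimensional ℝ Y) (hM : PropertyM Y) (hN : NoTree Y) : AUS Y := by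
  obtain ⟨f, hf1, hf2⟩ := exists_normseq Y
  have hnn : ∀ t, 0 < t → 0 ≤ rhoMod Y t := by
    intro t ht
    apply Real.sSup_nonneg
    rintro _ ⟨y, hy, rfl⟩
    apply Real.sInf_nonneg
    rintro _ ⟨Z, -, rfl⟩
    exact rho_sup_nonneg ht hy Z
  have main : ∀ c : ℝ, 0 < c → ∃ t0 : ℝ, 0 < t0 ∧ ∀ t, 0 < t → t ≤ t0 → rhoMod Y t ≤ c * t := by
    intro c hc
    obtain ⟨K, hK⟩ := hN (c / 2) (by positivity)
    refine ⟨1 / (K + 1), by positivity, fun t ht htK => ?_⟩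
    by_contra hcon
    push Not at hcon
    rw [le_div_iff₀ (by positivity)] at htK
    obtain ⟨y, hy, z, hz1, hzf, hyz⟩ := rhoMod_seq hY f ht (by positivity) hcon
    have hzw := weaklyNull_of hN hf1 hf2 hzf (fun n => (hz1 n).le)
    obtain ⟨σ, hσ, hP⟩ := exists_subseq_fin
      (fun F n => F.card ≤ K → ‖∑ i ∈ F, z i‖ + c / 2 ≤ ‖∑ i ∈ F, z i + z n‖) (by
        intro F
        by_cases hF : F.card ≤ K
        · have hs : ‖∑ i ∈ F, z i‖ ≤ K := by
            refine (norm_sum_le _ _).trans ?_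
            simp only [hz1, Finset.sum_const, nsmul_eq_mul, mul_one]
            exact_mod_cast hF
          refine (growth hM hzw hz1 hy ht hc hyz _ ?_).mono (fun n hn _ => hn)
          nlinarith
        · exact Eventually.of_forall (fun n h => absurd h hF))
    refine hK (z ∘ σ) (fun n => (hz1 _).le) (mazur hf1 hf2 ?_) ?_
    · intro n k hk
      exact hzf _ _ (hk.trans_le (hσ.id_le n))
    · intro A
      induction A using Finset.induction_on_max with
      | empty => simp
      | insert a s has ih =>
        intro hcard
        have hna : a ∉ s := fun h => lt_irrefl _ (has a h)
        rw [Finset.card_insert_of_notMem hna] at hcard ⊢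
        have ih := ih (by omega)
        have h1 := hP a (s.image σ) (Finset.image_subset_image (fun i hi =>
          Finset.mem_range.2 (has i hi))) (by
            rw [Finset.card_image_of_injective _ hσ.injective]; omega)
        rw [Finset.sum_image (fun i _ j _ h => hσ.injective h)] at h1
        rw [Finset.sum_insert hna, add_comm ((z ∘ σ) a)]
        simp only [Function.comp] at ih ⊢
        push_cast
        linarith
  rw [AUS, Metric.tendsto_nhdsWithin_nhds]
  intro ε hε
  obtain ⟨t0, ht0, h⟩ := main (ε / 2) (by positivity)
  refine ⟨t0, ht0, fun {t} ht htd => ?_⟩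
  have ht : 0 < t := ht
  rw [Real.dist_eq, sub_zero, abs_of_pos ht] at htd
  rw [Real.dist_eq, sub_zero, abs_of_nonneg (div_nonneg (hnn t ht) ht.le), div_lt_iff₀ ht]
  have := h t ht htd.le
  nlinarith

lemma fork_step {X Y : Type*} [NormedAddCommGroup X] [NormedSpace ℝ X]
    [NormedAddCommGroup Y] [NormedSpace ℝ Y] {S : Set X} {T : X → Y}
    {L : ℝ} (hL1 : 1 ≤ L) (hL : ∀ x ∈ S, ∀ x' ∈ S, ‖T x - T x'‖ ≤ L * ‖x - x'‖ + 1)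
    {c d : ℝ} (hc0 : 0 < c) (hd : 0 < d) (hco : ∀ r : ℝ, d ≤ r → ∀ x ∈ S, ∀ y : Y,
      ‖y - T x‖ ≤ c * r → ∃ x' ∈ S, ‖x' - x‖ ≤ r ∧ T x' = y)
    {t τ δ s : ℝ} (ht : 0 < t) (hs0 : 0 ≤ s) (hτ : τ ≤ t * c / (4 * L * (1 + s)))
    (hδ : δ ∈ betaModSet X τ) {z : ℕ → Y}
    (hsep : ∀ m n, m < n → 1 / 2 ≤ ‖z m - z n‖)
    (hev : ∀ v : Y, ‖v‖ = 1 → ∀ᶠ n in atTop, ‖v + t • z n‖ ≤ 1 + s ∧ ‖v - t • z n‖ ≤ 1 + s)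
    (x : X) (hx : x ∈ S) (y : Y) (R : ℝ) (hR : ‖y - T x‖ = R) (hRt : 16 / t ≤ R)
    (hRd : 4 * c * d ≤ R) :
    ∃ x' ∈ S, ‖x' - x‖ ≤ R / c * ((1 + s) * (1 - δ / 2)) ∧ T x' = y := by
  have hRp : 0 < R := lt_of_lt_of_le (by positivity) hRt
  have htR : 16 ≤ R * t := by rwa [div_le_iff₀ ht] at hRt
  have hv : ‖R⁻¹ • (y - T x)‖ = 1 := by
    rw [norm_smul, hR, Real.norm_of_nonneg (by positivity), inv_mul_cancel₀ hRp.ne']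
  have hyx : y = T x + R • (R⁻¹ • (y - T x)) := by
    rw [smul_smul, mul_inv_cancel₀ hRp.ne', one_smul]; abel
  set v := R⁻¹ • (y - T x) with hvdef
  obtain ⟨N, hN⟩ := eventually_atTop.1 (hev v hv)
  set ρ := R / 4 * (1 + s) / c with hρ
  have hcρ : c * ρ = R / 4 * (1 + s) := by rw [hρ]; field_simp
  have hρd : d ≤ ρ := by
    rw [hρ, le_div_iff₀ hc0]; nlinarith
  have hρ0 : 0 < ρ := hd.trans_le hρd
  obtain ⟨x1, hx1, hn1, hT1⟩ := hco ρ hρd x hx (T x + (R / 4) • v) (by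
    rw [add_sub_cancel_left, norm_smul, hv, Real.norm_of_nonneg (by positivity), hcρ]
    nlinarith)
  have h2 : ∀ n, ∃ x2 ∈ S, ‖x2 - x1‖ ≤ ρ ∧ T x2 = T x + (R / 2) • v + (R / 4 * t) • z (N + n) := by
    intro n
    apply hco ρ hρd x1 hx1
    have e : T x + (R / 2) • v + (R / 4 * t) • z (N + n) - T x1 = (R / 4) • (v + t • z (N + n)) := by
      rw [hT1]; module
    rw [e, norm_smul, Real.norm_of_nonneg (by positivity), hcρ]
    exact mul_le_mul_of_nonneg_left (hN _ (by omega)).1 (by positivity)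
  choose x2 hx2 hn2 hT2 using h2
  obtain ⟨n, hn⟩ := beta_scaled hδ.2 hρ0 x x1 x2 (by rw [norm_sub_rev]; exact hn1) hn2 (by
    intro m n hmn
    have h1 := hL _ (hx2 m) _ (hx2 n)
    have e : T (x2 m) - T (x2 n) = (R / 4 * t) • (z (N + m) - z (N + n)) := by
      rw [hT2, hT2]; module
    rw [e, norm_smul, Real.norm_of_nonneg (by positivity)] at h1
    have h3 := hsep (N + m) (N + n) (by omega)
    have h4 : R * t / 8 ≤ R / 4 * t * ‖z (N + m) - z (N + n)‖ := by
      have : 0 < R * t := by positivity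
      nlinarith
    have h5 : τ * ρ ≤ t * c / (4 * L * (1 + s)) * ρ := mul_le_mul_of_nonneg_right hτ hρ0.le
    have h6 : t * c / (4 * L * (1 + s)) * ρ = R * t / 16 / L := by
      rw [hρ]; field_simp; norm_num
    rw [h6] at h5
    refine h5.trans ?_
    rw [div_le_iff₀ (by linarith)]
    linarith)
  obtain ⟨x3, hx3, hn3, hT3⟩ := hco (2 * ρ) (by linarith) (x2 n) (hx2 n) y (by
    have e : y - T (x2 n) = (R / 2) • (v + ((1/2 : ℝ) * (-t)) • z (N + n)) := by
      rw [hT2]; nth_rw 1 [hyx]; module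
    rw [e, norm_smul, Real.norm_of_nonneg (by positivity)]
    have h1 := norm_convex v (z (N + n)) (a := -t) (s := 1/2) (by norm_num) (by norm_num)
    rw [neg_smul, ← sub_eq_add_neg] at h1
    have h2 := (hN (N + n) (by omega)).2
    rw [hv] at h1
    have h3 : ‖v + ((1/2 : ℝ) * (-t)) • z (N + n)‖ ≤ 1 + s := by linarith
    have := mul_le_mul_of_nonneg_left h3 (by positivity : 0 ≤ R / 2)
    linarith)
  refine ⟨x3, hx3, ?_, hT3⟩
  have h1 := norm_add_le (x3 - x2 n) (x2 n - x)
  rw [sub_add_sub_cancel, norm_sub_rev (x2 n) x] at h1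
  have h2 : R / c * ((1 + s) * (1 - δ / 2)) = 2 * ρ + 2 * (1 - δ) * ρ := by
    rw [hρ]; field_simp; ring
  rw [h2]; linarith

lemma fork {X Y : Type*} [NormedAddCommGroup X] [NormedSpace ℝ X]
    [NormedAddCommGroup Y] [NormedSpace ℝ Y] [Nontrivial Y] {S : Set X} {T : X → Y}
    (hsurj : T '' S = Set.univ)
    {L : ℝ} (hL1 : 1 ≤ L) (hL : ∀ x ∈ S, ∀ x' ∈ S, ‖T x - T x'‖ ≤ L * ‖x - x'‖ + 1)
    {c0 : ℝ} (hc0 : 0 < c0) (hco : ∀ r : ℝ, 1 ≤ r → ∀ x ∈ S, ∀ y : Y, ‖y - T x‖ ≤ c0 * r →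
      ∃ x' ∈ S, ‖x' - x‖ ≤ r ∧ T x' = y) (M : ℝ) (hM : 1 ≤ M) :
    ∃ C : ℝ, M ≤ C ∧ 2 ≤ C ∧ ∀ t, 0 < t → t ≤ M → ∀ δ ∈ betaModSet X (t / C), ∀ z : ℕ → Y,
      (∀ m n, m < n → 1 / 2 ≤ ‖z m - z n‖) → ∀ s ≤ M + 1,
      (∀ v : Y, ‖v‖ = 1 → ∀ᶠ n in atTop, ‖v + t • z n‖ ≤ 1 + s ∧ ‖v - t • z n‖ ≤ 1 + s) →
      δ / 2 ≤ s := by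
  let G : Set ℝ := {c | 0 < c ∧ ∃ d, 0 < d ∧ ∀ r : ℝ, d ≤ r → ∀ x ∈ S, ∀ y : Y,
      ‖y - T x‖ ≤ c * r → ∃ x' ∈ S, ‖x' - x‖ ≤ r ∧ T x' = y}
  have hGne : c0 ∈ G := ⟨hc0, 1, one_pos, hco⟩
  obtain ⟨x0, hx0⟩ : ∃ x, x ∈ S := by
    have : (0:Y) ∈ T '' S := by rw [hsurj]; trivial
    obtain ⟨x, hx, -⟩ := this
    exact ⟨x, hx⟩
  obtain ⟨e, he⟩ := exists_norm_eq Y (zero_le_one (α := ℝ))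
  have hGb : BddAbove G := by
    refine ⟨L + 1, ?_⟩
    rintro c ⟨hc, d, hd, h⟩
    obtain ⟨x', hx', h1, h2⟩ := h (max d 1) (le_max_left _ _) x0 hx0 (T x0 + (c * max d 1) • e) (by
      rw [add_sub_cancel_left, norm_smul, he, mul_one, Real.norm_of_nonneg (by positivity)])
    have h3 := hL x' hx' x0 hx0
    rw [h2, add_sub_cancel_left, norm_smul, he, mul_one, Real.norm_of_nonneg (by positivity)] at h3
    have h4 : 1 ≤ max d 1 := le_max_right _ _
    by_contra hcc
    push Not at hcc
    nlinarith
  have hg0 : 0 < sSup G := hc0.trans_le (le_csSup hGb hGne)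
  set g := sSup G with hg
  have hC1 : M ≤ max (max M 2) (8 * L * (M + 2) / g) := (le_max_left _ _).trans (le_max_left _ _)
  have hC2 : 2 ≤ max (max M 2) (8 * L * (M + 2) / g) := (le_max_right _ _).trans (le_max_left _ _)
  have hC3 : 8 * L * (M + 2) / g ≤ max (max M 2) (8 * L * (M + 2) / g) := le_max_right _ _
  refine ⟨max (max M 2) (8 * L * (M + 2) / g), hC1, hC2, ?_⟩
  set C := max (max M 2) (8 * L * (M + 2) / g)
  intro t ht htM δ hδ z hsep s hsM hev
  have hs0 : 0 ≤ s := by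
    obtain ⟨n, h1, h2⟩ := (hev e he).exists
    have h3 := norm_add_le (e + t • z n) (e - t • z n)
    have h4 : e + t • z n + (e - t • z n) = (2:ℝ) • e := by module
    rw [h4, norm_smul, he] at h3
    norm_num at h3
    linarith
  by_contra hcon
  push Not at hcon
  set κ := max (1/2) ((1 + s) * (1 - δ / 2)) with hκ
  have hκ0 : 1/2 ≤ κ := le_max_left _ _
  have hκ1 : κ < 1 := by
    apply max_lt (by norm_num)
    rcases le_total (1 - δ / 2) 0 with h | h
    · nlinarith
    · nlinarith
  obtain ⟨c, ⟨hc, d, hd, hcG⟩, hcg⟩ := exists_lt_of_lt_csSup ⟨c0, hGne⟩ (show κ * g < sSup G by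
    rw [← hg]; nlinarith)
  have hτ : t / C ≤ t * c / (4 * L * (1 + s)) := by
    have hCp : 0 < C := by linarith
    rw [div_le_div_iff₀ hCp (by positivity)]
    have h1 : 8 * L * (M + 2) ≤ C * g := by rwa [div_le_iff₀ hg0] at hC3
    have h2 : g / 2 ≤ c := by nlinarith
    have h3 : C * (g / 2) ≤ C * c := mul_le_mul_of_nonneg_left h2 hCp.le
    have h4 : 4 * L * (1 + s) ≤ 4 * L * (M + 2) := mul_le_mul_of_nonneg_left (by linarith) (by linarith)
    have h5 : 4 * L * (1 + s) ≤ C * c := by linarith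
    have := mul_le_mul_of_nonneg_left h5 ht.le
    linarith
  have hmem : c / κ ∈ G := by
    have hκp : 0 < κ := by linarith
    set R0 := max (16 / t) (4 * c * d) with hR0
    refine ⟨by positivity, max d (R0 / c), lt_max_of_lt_left hd, fun r hr x hx y hy => ?_⟩
    have hrd : d ≤ r := (le_max_left _ _).trans hr
    have hrR : R0 / c ≤ r := (le_max_right _ _).trans hr
    rcases le_total ‖y - T x‖ R0 with h | h
    · apply hcG r hrd x hx y
      rw [div_le_iff₀ hc] at hrR
      linarith
    · obtain ⟨x', hx', h1, h2⟩ := fork_step hL1 hL hc hd hcG ht hs0 hτ hδ hsep hev x hx y _ rfl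
        ((le_max_left _ _).trans h) ((le_max_right _ _).trans h)
      refine ⟨x', hx', h1.trans ?_, h2⟩
      have h3 : ‖y - T x‖ / c * ((1 + s) * (1 - δ / 2)) ≤ ‖y - T x‖ / c * κ :=
        mul_le_mul_of_nonneg_left (le_max_right _ _) (by positivity)
      refine h3.trans ?_
      have h4 : ‖y - T x‖ / c * κ ≤ (c / κ * r) / c * κ := by gcongr
      refine h4.trans (le_of_eq ?_)
      field_simp
  have h1 := le_csSup hGb hmem
  rw [← hg, div_le_iff₀ (by linarith)] at h1
  linarith

lemma deltaAt_seq {Y : Type*} [NormedAddCommGroup Y] [NormedSpace ℝ Y]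
    (hY : ¬ FiniteDimensional ℝ Y) (f : ℕ → Y →L[ℝ] ℝ) {t : ℝ} (ht : 0 < t) {y : Y}
    (hy : ‖y‖ = 1) :
    deltaAt t y ≤ t ∧ ∀ s, deltaAt t y < s → ∃ z : ℕ → Y, (∀ n, ‖z n‖ = 1) ∧
      (∀ n, ∀ k < n, f k (z n) = 0) ∧ ∀ n, ‖y + t • z n‖ ≤ 1 + s := by
  have hbb : ∀ Z : Subspace ℝ Y, BddBelow {r | ∃ z ∈ Z, ‖z‖ = 1 ∧ r = ‖y + t • z‖ - 1} := by
    intro Z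
    refine ⟨-1, ?_⟩
    rintro _ ⟨z, -, -, rfl⟩
    linarith [norm_nonneg (y + t • z)]
  have hle : ∀ Z : Subspace ℝ Y, sInf {r | ∃ z ∈ Z, ‖z‖ = 1 ∧ r = ‖y + t • z‖ - 1} ≤ t := by
    intro Z
    by_cases hne : ∃ z ∈ Z, ‖z‖ = 1
    · obtain ⟨z, hz, hz1⟩ := hne
      exact (csInf_le (hbb Z) ⟨z, hz, hz1, rfl⟩).trans (rho_bdd ht hy hz1)
    · have : {r | ∃ z ∈ Z, ‖z‖ = 1 ∧ r = ‖y + t • z‖ - 1} = ∅ := by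
        rw [Set.eq_empty_iff_forall_notMem]
        rintro _ ⟨z, h1, h2, -⟩
        exact hne ⟨z, h1, h2⟩
      rw [this, Real.sInf_empty]; exact ht.le
  refine ⟨Real.sSup_le (by rintro _ ⟨Z, -, rfl⟩; exact hle Z) ht.le, fun s hs => ?_⟩
  have : ∀ n, ∃ z : Y, ‖z‖ = 1 ∧ (∀ k < n, f k z = 0) ∧ ‖y + t • z‖ ≤ 1 + s := by
    intro n
    obtain ⟨Z, hZ, hZf, z0, hz0, hz01⟩ := exists_Z hY f n
    have h1 : sInf {r | ∃ z ∈ Z, ‖z‖ = 1 ∧ r = ‖y + t • z‖ - 1} ≤ deltaAt t y := by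
      apply le_csSup
      · refine ⟨t, ?_⟩
        rintro _ ⟨Z, -, rfl⟩
        exact hle Z
      · exact ⟨Z, hZ, rfl⟩
    obtain ⟨_, ⟨z, hz, hz1, rfl⟩, hlt⟩ := exists_lt_of_csInf_lt
      (by exact ⟨_, z0, hz0, hz01, rfl⟩) (h1.trans_lt hs)
    exact ⟨z, hz1, hZf z hz, by linarith⟩
  choose z h1 h2 h3 using this
  exact ⟨z, h1, h2, h3⟩

lemma key_delta {X Y : Type*} [NormedAddCommGroup X] [NormedSpace ℝ X]
    [NormedAddCommGroup Y] [NormedSpace ℝ Y] [TopologicalSpace.SeparableSpace Y]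
    (hY : ¬ FiniteDimensional ℝ Y) (hPM : PropertyM Y) (hN : NoTree Y) {S : Set X} {T : X → Y}
    (hsurj : T '' S = Set.univ)
    {L : ℝ} (hL1 : 1 ≤ L) (hL : ∀ x ∈ S, ∀ x' ∈ S, ‖T x - T x'‖ ≤ L * ‖x - x'‖ + 1)
    {c0 : ℝ} (hc0 : 0 < c0) (hco : ∀ r : ℝ, 1 ≤ r → ∀ x ∈ S, ∀ y : Y, ‖y - T x‖ ≤ c0 * r →
      ∃ x' ∈ S, ‖x' - x‖ ≤ r ∧ T x' = y) (M : ℝ) (hM : 1 ≤ M) :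
    ∃ C : ℝ, M ≤ C ∧ 2 ≤ C ∧ ∀ t, 0 < t → t ≤ M → ∀ δ ∈ betaModSet X (t / C),
      δ / 2 ≤ deltaMod Y t := by
  have hnt : Nontrivial Y := by
    by_contra h
    rw [not_nontrivial_iff_subsingleton] at h
    exact hY inferInstance
  obtain ⟨C, hCM, hC2, hC⟩ := fork hsurj hL1 hL hc0 hco M hM
  refine ⟨C, hCM, hC2, fun t ht htM δ hδ => ?_⟩
  obtain ⟨f, hf1, hf2⟩ := exists_normseq Y
  obtain ⟨e, he⟩ := exists_norm_eq Y (zero_le_one (α := ℝ))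
  refine le_csInf (by exact ⟨_, e, he, rfl⟩) ?_
  rintro _ ⟨y, hy, rfl⟩
  obtain ⟨hdt, hseq⟩ := deltaAt_seq hY f ht hy
  apply le_of_forall_pos_le_add
  intro ε' hε'
  obtain ⟨ε, hε, hε1, hε2⟩ : ∃ ε : ℝ, 0 < ε ∧ ε ≤ 1 ∧ ε ≤ ε' :=
    ⟨min 1 ε', lt_min one_pos hε', min_le_left _ _, min_le_right _ _⟩
  obtain ⟨z, hz1, hzf, hyz⟩ := hseq (deltaAt t y + ε / 2) (by linarith)
  have hzw := weaklyNull_of hN hf1 hf2 hzf (fun n => (hz1 n).le)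
  obtain ⟨σ, hσ, hP⟩ := exists_subseq_fin (fun F n => ∀ m ∈ F, 1 / 2 ≤ ‖z m - z n‖) (by
    intro F
    rw [Filter.eventually_all_finset]
    intro m _
    obtain ⟨N, hN⟩ := mazur hf1 hf2 hzf {m}
    refine eventually_atTop.2 ⟨N, fun n hn => ?_⟩
    have := hN {n} (by simpa using hn)
    simp only [Finset.sum_singleton, hz1] at this
    linarith)
  have htz : ∀ n, ‖t • z n‖ ≤ t := by
    intro n; rw [norm_smul, hz1, Real.norm_of_nonneg ht.le, mul_one]
  have hres := hC t ht htM δ hδ (fun n => z (σ n)) (by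
      intro m n hmn
      exact hP n {σ m} (by
        simpa using ⟨m, hmn, rfl⟩) _ (by simp)) (deltaAt t y + ε) (by linarith) (by
      intro v hv
      have h1 := M_eventually hPM ((hzw.subseq hσ).smul t) (fun n => htz (σ n)) hy hv
        (show 1 + (deltaAt t y + ε / 2) < 1 + (deltaAt t y + ε) by linarith) (fun n => hyz (σ n))
      have h2 := M_eventually hPM ((hzw.subseq hσ).smul t) (fun n => htz (σ n)) hy
        (v := -v) (by rw [norm_neg, hv])
        (show 1 + (deltaAt t y + ε / 2) < 1 + (deltaAt t y + ε) by linarith) (fun n => hyz (σ n))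
      filter_upwards [h1, h2] with n h3 h4
      refine ⟨h3.le, ?_⟩
      rw [← norm_neg, neg_sub, sub_eq_neg_add]
      exact h4.le)
  linarith

/-- Theorem `g_thm1`. -/
theorem stmt15 {X Y : Type*} [NormedAddCommGroup X] [NormedSpace ℝ X] [CompleteSpace X]
    [NormedAddCommGroup Y] [NormedSpace ℝ Y] [CompleteSpace Y]
    [TopologicalSpace.SeparableSpace Y]
    (hX : ¬ FiniteDimensional ℝ X) (hY : ¬ FiniteDimensional ℝ Y)
    (hβ : PropertyBeta X) (hM : PropertyM Y)
    (S : Set X) (T : X → Y) (hsurj : T '' S = Set.univ)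
    (hT : UniformQuotientOn T S) (hLip : LipschitzLargeDist T S) :
    AUS Y ∧ AUC Y ∧
      ∃ C : ℝ, 1 ≤ C ∧ ∀ t : ℝ, 0 < t → t ≤ 1 →
        (1 / C) * betaMod X (t / C) ≤ deltaMod Y t := by
  obtain ⟨L, hL1, hL⟩ := lip_large hT hLip
  obtain ⟨c0, hc0, hco⟩ := colip_large hT
  have hN : NoTree Y := fun c hc => tree_lemma hβ hsurj hL1 hL hc0 hco c hc
  have hK := key_delta hY hM hN hsurj hL1 hL hc0 hco
  refine ⟨aus_of hY hM hN, ?_, ?_⟩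
  · intro t ht
    obtain ⟨C, hCM, hC2, hC⟩ := hK (max t 1) (le_max_right _ _)
    obtain ⟨a, ha1, -, hβ⟩ := hβ
    have htC : t / C ≤ 1 := by
      rw [div_le_one (by linarith)]; exact (le_max_left _ _).trans hCM
    obtain ⟨δ, hδ, h⟩ := hβ (t / C) (by positivity) (htC.trans ha1)
    have := hC t ht (le_max_left _ _) δ ⟨hδ.le, h⟩
    linarith
  · obtain ⟨C, hCM, hC2, hC⟩ := hK 1 le_rfl
    refine ⟨C, hCM, fun t ht ht1 => ?_⟩
    obtain ⟨a, ha1, -, hβ⟩ := hβ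
    have htC : t / C ≤ 1 := by
      rw [div_le_one (by linarith)]; linarith
    obtain ⟨δ, hδ, h⟩ := hβ (t / C) (by positivity) (htC.trans ha1)
    have h0 := hC t ht ht1 δ ⟨hδ.le, h⟩
    have h1 : betaMod X (t / C) ≤ 2 * deltaMod Y t := by
      apply Real.sSup_le _ (by linarith)
      intro δ hδ
      linarith [hC t ht ht1 δ hδ]
    have h2 : 1 / C * betaMod X (t / C) ≤ 1 / C * (2 * deltaMod Y t) :=
      mul_le_mul_of_nonneg_left h1 (by positivity)
    refine h2.trans ?_
    rw [one_div, inv_mul_le_iff₀ (by linarith)]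
    nlinarith

end
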